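/- Let b₁, …, b_r ∈ ℂ be distinct and nonzero, let m₁, …, m_r ≥ 1 be integers, and set P(X) := ∏_{j=1}^r (1 − b_j·X)^{m_j} and, for each j, P_j(X) := ∏_{i ≠ j} (1 − b_i·X)^{m_i}. Let Q(X) = ∑_{n=−N}^{M} q_n·Xⁿ be a Laurent polynomial whose top exponent M satisfies M < ∑_{j=1}^r m_j. Let a : ℤ → ℂ be such that a(n) = 0 for n < −N and, for every X with 0 < |X| < min_j |b_j|⁻¹, the series ∑_{n ∈ ℤ} a(n)·Xⁿ converges (HasSum) to Q(X)/P(X). For 1 ≤ j ≤ r and 0 ≤ k ≤ m_j − 1 set C_{j,k} := ((−1)ᵏ/(k!·b_jᵏ)) · (the k-th derivative of the function z ↦ Q(z)/P_j(z), evaluated at z = b_j⁻¹). Then for every X with |X| < min_j |b_j|⁻¹: P(X) · ∑_{n ∈ ℕ} a(n)·Xⁿ = ∑_{j=1}^r ∑_{k=0}^{m_j−1} C_{j,k} · (1 − b_j·X)ᵏ · P_j(X). -/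

import Mathlib

open Polynomial Filter Topology

theorem aux_taylor (w : ℂ) (m : ℕ) : ∀ (f : ℂ → ℂ) (p : FormalMultilinearSeries ℂ ℂ ℂ),
    HasFPowerSeriesAt f p w → ∃ g : ℂ → ℂ, ContinuousAt g w ∧
      ∀ z, f z = ∑ k ∈ Finset.range m, p.coeff k * (z - w) ^ k + (z - w) ^ m * g z := by
  induction m with
  | zero => intro f p hp; exact ⟨f, hp.continuousAt, by simp⟩
  | succ m ih =>
    intro f p hp
    obtain ⟨g, hg, h⟩ := ih _ _ hp.has_fpower_series_dslope_fslope
    refine ⟨g, hg, fun z => ?_⟩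
    have h0 : p.coeff 0 = f w := hp.coeff_zero 1
    have h1 : f z = f w + (z - w) * dslope f w z := by
      have := sub_smul_dslope f w z
      rw [smul_eq_mul] at this
      rw [this]; ring
    rw [h1, h z, Finset.sum_range_succ', h0]
    simp only [FormalMultilinearSeries.coeff_fslope, mul_add, Finset.mul_sum]
    have : ∀ k, (z - w) * (p.coeff (k+1) * (z-w)^k) = p.coeff (k+1) * (z-w)^(k+1) := by
      intro k; ring
    simp only [this]
    ring

theorem aux_taylor' (w : ℂ) (m : ℕ) (f : ℂ → ℂ) (hf : AnalyticAt ℂ f w) :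
    ∃ g : ℂ → ℂ, ContinuousAt g w ∧
      ∀ z, f z = ∑ k ∈ Finset.range m, iteratedDeriv k f w / (k.factorial : ℂ) * (z - w) ^ k
        + (z - w) ^ m * g z := by
  obtain ⟨g, hg, h⟩ := aux_taylor w m f _ hf.hasFPowerSeriesAt
  refine ⟨g, hg, fun z => ?_⟩
  rw [h z]
  simp [FormalMultilinearSeries.coeff_ofScalars]

theorem aux_dvd (w : ℂ) (H : ℂ → ℂ) (hH : ContinuousAt H w) (n : ℕ) : ∀ (S : ℂ[X]),
    (∀ᶠ z in 𝓝[≠] w, S.eval z = (z - w) ^ n * H z) →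
    ∃ R : ℂ[X], S = (X - C w) ^ n * R ∧ R.eval w = H w := by
  induction n with
  | zero =>
    intro S h
    refine ⟨S, by simp, ?_⟩
    have h1 : Tendsto (fun z => S.eval z) (𝓝[≠] w) (𝓝 (S.eval w)) :=
      S.continuous.continuousAt.tendsto.mono_left nhdsWithin_le_nhds
    have h2 : Tendsto H (𝓝[≠] w) (𝓝 (H w)) := hH.tendsto.mono_left nhdsWithin_le_nhds
    refine tendsto_nhds_unique (h1.congr' ?_) h2
    filter_upwards [h] with z hz
    simpa using hz
  | succ n ih =>
    intro S h
    have h1 : Tendsto (fun z => S.eval z) (𝓝[≠] w) (𝓝 (S.eval w)) :=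
      S.continuous.continuousAt.tendsto.mono_left nhdsWithin_le_nhds
    have h2 : Tendsto (fun z => (z - w) ^ (n+1) * H z) (𝓝[≠] w) (𝓝 ((w - w) ^ (n+1) * H w)) := by
      refine Tendsto.mono_left ?_ nhdsWithin_le_nhds
      exact Tendsto.mul (Continuous.tendsto (by fun_prop) w) hH
    have h3 : S.eval w = 0 := by
      have := tendsto_nhds_unique (h1.congr' h) h2
      simpa using this
    obtain ⟨T, rfl⟩ := dvd_iff_isRoot.mpr h3
    obtain ⟨R, hR, hR0⟩ := ih T (by
      filter_upwards [h, self_mem_nhdsWithin] with z hz hzw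
      have : z - w ≠ 0 := sub_ne_zero.mpr hzw
      apply mul_left_cancel₀ this
      simp only [eval_mul, eval_sub, eval_X, eval_C] at hz
      rw [hz]; ring)
    exact ⟨R, by rw [hR]; ring, hR0⟩

/-- Hermite interpolation. -/
theorem aux_hermite (r : ℕ) (b : Fin r → ℂ) (hb0 : ∀ j, b j ≠ 0) (hbinj : Function.Injective b)
    (m : Fin r → ℕ) (R : ℂ[X]) (hR : R.degree < ((∑ j, m j : ℕ) : WithBot ℕ))
    (c : Fin r → ℕ → ℂ)
    (h : ∀ j, ((1 : ℂ[X]) - C (b j) * X) ^ m j ∣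
      R - ∑ k ∈ Finset.range (m j), C (c j k) * (1 - C (b j) * X) ^ k *
        ∏ i ∈ Finset.univ.erase j, (1 - C (b i) * X) ^ m i) :
    R = ∑ j, ∑ k ∈ Finset.range (m j), C (c j k) * (1 - C (b j) * X) ^ k *
        ∏ i ∈ Finset.univ.erase j, (1 - C (b i) * X) ^ m i := by
  have hdeg : ∀ j, ((1 : ℂ[X]) - C (b j) * X).degree = 1 := by
    intro j
    have : (1 : ℂ[X]) - C (b j) * X = C (-(b j)) * X + C 1 := by simp; ring
    rw [this, degree_linear (neg_ne_zero.mpr (hb0 j))]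
  rw [← sub_eq_zero]
  apply eq_zero_of_dvd_of_degree_lt (p := ∏ j, ((1 : ℂ[X]) - C (b j) * X) ^ m j)
  · apply Fintype.prod_dvd_of_coprime
    · intro i j hij
      apply IsCoprime.pow
      have hij' : b i - b j ≠ 0 := sub_ne_zero.mpr (hbinj.ne hij)
      refine ⟨C (- b j / (b i - b j)), C (b i / (b i - b j)), ?_⟩
      have : C (- b j / (b i - b j)) * (1 - C (b i) * X) + C (b i / (b i - b j)) * (1 - C (b j) * X)
        = C ((- b j + b i) / (b i - b j)) := by
        simp only [div_eq_mul_inv, C_mul, C_add, C_neg]; ring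
      rw [this, neg_add_eq_sub, div_self hij', C_1]
    · intro j
      rw [← Finset.add_sum_erase _ _ (Finset.mem_univ j), ← sub_sub]
      apply dvd_sub (h j)
      apply Finset.dvd_sum
      intro i hi
      apply Finset.dvd_sum
      intro k _
      apply Dvd.dvd.mul_left
      apply Finset.dvd_prod_of_mem (fun i => ((1 : ℂ[X]) - C (b i) * X) ^ m i)
      simpa using (Finset.ne_of_mem_erase hi).symm
  · have hP : (∏ j, ((1 : ℂ[X]) - C (b j) * X) ^ m j).degree = ((∑ j, m j : ℕ) : WithBot ℕ) := by
      rw [degree_prod]; simp [degree_pow, hdeg]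
    rw [hP]
    refine (degree_sub_le _ _).trans_lt (max_lt hR ?_)
    rw [← mem_degreeLT]
    refine Submodule.sum_mem _ fun j _ => Submodule.sum_mem _ fun k hk => ?_
    rw [mul_assoc, ← smul_eq_C_mul]
    refine Submodule.smul_mem _ _ ?_
    rw [mem_degreeLT]
    rw [degree_mul, degree_prod, ← Finset.add_sum_erase _ _ (Finset.mem_univ j)]
    simp only [degree_pow, hdeg]
    have := Finset.mem_range.mp hk
    simp only [nsmul_eq_mul, mul_one]
    exact_mod_cast Nat.add_lt_add_right this _

theorem aux_split (N : ℕ) (a : ℤ → ℂ) (ha : ∀ n : ℤ, n < -(N : ℤ) → a n = 0) (x s : ℂ)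
    (hx : x ≠ 0) (h : HasSum (fun n : ℤ => a n * x ^ n) s) :
    Summable (fun n : ℕ => a (n : ℤ) * x ^ n) ∧
    x ^ N * s = x ^ N * (∑' n : ℕ, a (n : ℤ) * x ^ n)
      + ∑ k ∈ Finset.range N, a ((k : ℤ) - N) * x ^ k := by
  have h1 : HasSum (fun n : ℤ => a (n - N) * x ^ (n - N)) s := by
    have h0 := (Equiv.subRight (N : ℤ)).hasSum_iff (f := fun n : ℤ => a n * x ^ n) (a := s)
    simp only [Function.comp_def, Equiv.subRight_apply] at h0
    exact h0.mpr h
  have h2 : HasSum (fun n : ℕ => a ((n : ℤ) - N) * x ^ ((n : ℤ) - N)) s := by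
    refine (Function.Injective.hasSum_iff (Nat.cast_injective (R := ℤ)) ?_).mpr h1
    intro n hn
    have : n < 0 := by
      by_contra hneg
      exact hn ⟨n.toNat, Int.toNat_of_nonneg (not_lt.mp hneg)⟩
    rw [ha _ (by omega), zero_mul]
  have h3 := h2.summable.sum_add_tsum_nat_add N
  rw [h2.tsum_eq] at h3
  constructor
  · simpa [Function.comp_def] using h.summable.comp_injective (Nat.cast_injective (R := ℤ))
  · rw [← h3, mul_add, add_comm, Finset.mul_sum]
    congr 1
    · congr 1
      apply tsum_congr
      intro n
      simp
    · apply Finset.sum_congr rfl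
      intro k _
      rw [zpow_sub₀ hx]
      have : x ^ N ≠ 0 := pow_ne_zero _ hx
      simp only [zpow_natCast]
      field_simp

theorem laurent_truncation_rational
    (r : ℕ) (b : Fin r → ℂ) (hb0 : ∀ j, b j ≠ 0) (hbinj : Function.Injective b)
    (m : Fin r → ℕ) (hm : ∀ j, 1 ≤ m j)
    (N : ℕ) (M : ℤ) (hM : M < ∑ j, (m j : ℤ))
    (qc : ℤ → ℂ) (Q : ℂ → ℂ)
    (hQ : ∀ X : ℂ, Q X = ∑ n ∈ Finset.Icc (-(N : ℤ)) M, qc n * X ^ n)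
    (a : ℤ → ℂ) (ha : ∀ n : ℤ, n < -(N : ℤ) → a n = 0)
    (hf : ∀ X : ℂ, 0 < ‖X‖ → (∀ j, ‖X‖ < ‖b j‖⁻¹) →
      HasSum (fun n : ℤ => a n * X ^ n) (Q X / ∏ j, (1 - b j * X) ^ m j)) :
    ∀ X : ℂ, (∀ j, ‖X‖ < ‖b j‖⁻¹) →
      (∏ j, (1 - b j * X) ^ m j) * (∑' n : ℕ, a (n : ℤ) * X ^ n)
        = ∑ j, ∑ k ∈ Finset.range (m j),
            (((-1 : ℂ) ^ k / ((k.factorial : ℂ) * b j ^ k)) *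
                iteratedDeriv k
                  (fun z => Q z / ∏ i ∈ Finset.univ.erase j, (1 - b i * z) ^ m i)
                  (b j)⁻¹) *
              (1 - b j * X) ^ k *
              ∏ i ∈ Finset.univ.erase j, (1 - b i * X) ^ m i := by
  -- a radius inside the disk
  obtain ⟨ρ, hρ, hρ0⟩ : ∃ ρ : ℝ, (∀ j, ρ < ‖b j‖⁻¹) ∧ 0 < ρ := by
    have h1 : ∀ᶠ ρ in 𝓝[>] (0 : ℝ), ∀ j, ρ < ‖b j‖⁻¹ := by
      rw [Filter.eventually_all]
      intro j
      refine Filter.Eventually.filter_mono nhdsWithin_le_nhds ?_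
      exact eventually_lt_nhds (inv_pos.mpr (norm_pos_iff.mpr (hb0 j)))
    exact (h1.and self_mem_nhdsWithin).exists
  have hPne : ∀ x : ℂ, (∀ j, ‖x‖ < ‖b j‖⁻¹) → ∏ j, (1 - b j * x) ^ m j ≠ 0 := by
    intro x hx
    refine Finset.prod_ne_zero_iff.mpr fun j _ => pow_ne_zero _ ?_
    intro h0
    have h1 : x = (b j)⁻¹ := by
      have := hb0 j
      field_simp
      linear_combination -h0
    have := hx j
    rw [h1, norm_inv] at this
    exact lt_irrefl _ this
  set F : ℂ → ℂ := fun x => ∑' n : ℕ, a (n : ℤ) * x ^ n with hF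
  have hFc : ContinuousAt F 0 := by
    have hρn : ‖(ρ : ℂ)‖ = ρ := by simp [abs_of_pos hρ0]
    have hs := (aux_split N a ha (ρ : ℂ) _ (by exact_mod_cast hρ0.ne')
      (hf ρ (by rw [hρn]; exact hρ0) (by rw [hρn]; exact hρ))).1
    have : ContinuousOn F (Metric.closedBall 0 ρ) := by
      refine continuousOn_tsum (u := fun n : ℕ => ‖a (n : ℤ) * (ρ : ℂ) ^ n‖)
        (fun n => by fun_prop) hs.norm ?_
      intro n x hx
      rw [norm_mul, norm_mul, norm_pow, norm_pow, hρn]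
      have : ‖x‖ ≤ ρ := by simpa using hx
      gcongr
    exact this.continuousAt (Metric.closedBall_mem_nhds 0 hρ0)
  -- polynomials
  set P : ℂ[X] := ∏ j, (1 - C (b j) * X) ^ m j with hP
  have hPe : ∀ x, P.eval x = ∏ j, (1 - b j * x) ^ m j := by
    intro x; simp [hP, eval_prod]
  set G : ℂ[X] := ∑ k ∈ Finset.range N, C (a ((k : ℤ) - N)) * X ^ k with hG
  set T : ℂ[X] := ∑ n ∈ Finset.Icc (-(N : ℤ)) M, C (qc n) * X ^ (n + N).toNat with hT
  have hTe : ∀ x : ℂ, x ≠ 0 → T.eval x = x ^ N * Q x := by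
    intro x hx
    rw [hQ, hT, eval_finsetSum, Finset.mul_sum]
    refine Finset.sum_congr rfl fun n hn => ?_
    have hn' := (Finset.mem_Icc.mp hn).1
    have : x ^ (n + N).toNat = x ^ n * x ^ N := by
      rw [← zpow_natCast, ← zpow_natCast, ← zpow_add₀ hx, Int.toNat_of_nonneg (by omega)]
    simp only [eval_mul, eval_C, eval_pow, eval_X, this]
    ring
  have hGe : ∀ x : ℂ, G.eval x = ∑ k ∈ Finset.range N, a ((k : ℤ) - N) * x ^ k := by
    intro x; simp [hG, eval_finsetSum]
  have hS : ∀ x : ℂ, x ≠ 0 → (∀ j, ‖x‖ < ‖b j‖⁻¹) →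
      (T - G * P).eval x = (x - 0) ^ N * (P.eval x * F x) := by
    intro x hx hxb
    have h1 := (aux_split N a ha x _ hx (hf x (norm_pos_iff.mpr hx) hxb)).2
    have h2 := hPne x hxb
    rw [← hPe] at h1 h2
    rw [eval_sub, eval_mul, hTe x hx, hGe, sub_zero]
    field_simp at h1
    linear_combination h1
  have hdisk : ∀ᶠ x in 𝓝 (0 : ℂ), ∀ j, ‖x‖ < ‖b j‖⁻¹ := by
    filter_upwards [Metric.ball_mem_nhds (0 : ℂ) hρ0] with x hx j
    exact lt_trans (by simpa using hx) (hρ j)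
  obtain ⟨R, hR, hR0⟩ := aux_dvd 0 (fun x => P.eval x * F x)
    (P.continuous.continuousAt.mul hFc) N (T - G * P) (by
      filter_upwards [nhdsWithin_le_nhds hdisk, self_mem_nhdsWithin] with x hx hx0
      exact hS x hx0 hx)
  rw [C_0, sub_zero] at hR
  have hRe : ∀ x : ℂ, (∀ j, ‖x‖ < ‖b j‖⁻¹) → R.eval x = P.eval x * F x := by
    intro x hx
    by_cases hx0 : x = 0
    · rw [hx0]; exact hR0
    · have := hS x hx0 hx
      rw [hR, eval_mul, eval_pow, eval_X, sub_zero] at this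
      exact mul_left_cancel₀ (pow_ne_zero _ hx0) this
  have hPd : P.degree = ((∑ j, m j : ℕ) : WithBot ℕ) := by
    have hdeg : ∀ j, ((1 : ℂ[X]) - C (b j) * X).degree = 1 := by
      intro j
      have : (1 : ℂ[X]) - C (b j) * X = C (-(b j)) * X + C 1 := by simp; ring
      rw [this, degree_linear (neg_ne_zero.mpr (hb0 j))]
    rw [hP, degree_prod]; simp [degree_pow, hdeg]
  have hRd : R.degree < ((∑ j, m j : ℕ) : WithBot ℕ) := by
    have h1 : T - G * P ∈ degreeLT ℂ (N + ∑ j, m j) := by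
      refine Submodule.sub_mem _ ?_ ?_
      · refine Submodule.sum_mem _ fun n hn => ?_
        rw [← smul_eq_C_mul]
        refine Submodule.smul_mem _ _ ?_
        rw [mem_degreeLT, degree_X_pow]
        have := Finset.mem_Icc.mp hn
        have h3 : n < ((∑ j, m j : ℕ) : ℤ) := by push_cast; omega
        norm_cast
        omega
      · rw [hG, Finset.sum_mul]
        refine Submodule.sum_mem _ fun k hk => ?_
        rw [mul_assoc, ← smul_eq_C_mul]
        refine Submodule.smul_mem _ _ ?_
        rw [mem_degreeLT, degree_mul, degree_X_pow, hPd]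
        have := Finset.mem_range.mp hk
        norm_cast
        omega
    rw [hR, mem_degreeLT, degree_mul, degree_X_pow] at h1
    by_cases hR00 : R = 0
    · rw [hR00, degree_zero]; exact WithBot.bot_lt_coe _
    · rw [degree_eq_natDegree hR00] at h1 ⊢
      norm_cast at h1 ⊢
      omega
  have key := aux_hermite r b hb0 hbinj m R hRd
    (fun j k => ((-1 : ℂ) ^ k / ((k.factorial : ℂ) * b j ^ k)) *
                iteratedDeriv k
                  (fun z => Q z / ∏ i ∈ Finset.univ.erase j, (1 - b i * z) ^ m i)
                  (b j)⁻¹) (by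
    intro j
    set w : ℂ := (b j)⁻¹ with hw
    have hw0 : w ≠ 0 := inv_ne_zero (hb0 j)
    have hbw : ∀ z, 1 - b j * z = (-b j) * (z - w) := by
      intro z
      have := hb0 j
      rw [hw]; field_simp; ring
    set Pj : ℂ → ℂ := fun z => ∏ i ∈ Finset.univ.erase j, (1 - b i * z) ^ m i with hPj
    have hPja : AnalyticAt ℂ Pj w := by
      apply Finset.analyticAt_fun_prod
      intro i _
      fun_prop
    have hPjw : Pj w ≠ 0 := by
      refine Finset.prod_ne_zero_iff.mpr fun i hi => pow_ne_zero _ ?_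
      intro h0
      apply Finset.ne_of_mem_erase hi
      apply hbinj
      have := hb0 j
      rw [hw] at h0
      field_simp at h0
      linear_combination -h0
    have hQa : AnalyticAt ℂ Q w := by
      have : Q = fun X => ∑ n ∈ Finset.Icc (-(N : ℤ)) M, qc n * X ^ n := funext hQ
      rw [this]
      apply Finset.analyticAt_fun_sum
      intro n _
      exact analyticAt_const.mul (analyticAt_id.zpow hw0)
    obtain ⟨g, hg, hgz⟩ := aux_taylor' w (m j) (fun z => Q z / Pj z) (hQa.div hPja hPjw)
    obtain ⟨U, hU, -⟩ := aux_dvd w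
      (fun z => Pj z * g z - (z ^ N)⁻¹ * G.eval z * (Pj z * (-b j) ^ m j)) (by
        have h1 := hPja.continuousAt
        have h2 : ContinuousAt (fun z : ℂ => (z ^ N)⁻¹) w :=
          ContinuousAt.inv₀ (by fun_prop) (pow_ne_zero _ hw0)
        have h3 : ContinuousAt (fun z : ℂ => G.eval z) w := G.continuous.continuousAt
        fun_prop) (m j)
      (R - ∑ k ∈ Finset.range (m j), C (((-1 : ℂ) ^ k / ((k.factorial : ℂ) * b j ^ k)) *
          iteratedDeriv k (fun z => Q z / Pj z) w) * (1 - C (b j) * X) ^ k *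
        ∏ i ∈ Finset.univ.erase j, (1 - C (b i) * X) ^ m i) (by
        refine Filter.Eventually.filter_mono nhdsWithin_le_nhds ?_
        filter_upwards [hPja.continuousAt.eventually_ne hPjw, eventually_ne_nhds hw0]
          with z hz1 hz0
        have e1 : P.eval z = Pj z * ((-b j) ^ m j * (z - w) ^ m j) := by
          rw [hPe, ← Finset.mul_prod_erase _ _ (Finset.mem_univ j), hbw, mul_pow]
          ring
        have e2 : z ^ N * R.eval z = z ^ N * Q z - G.eval z * P.eval z := by
          rw [← hTe z hz0, ← eval_mul, ← eval_sub, hR]; simp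
        have e3 : R.eval z = Q z - (z ^ N)⁻¹ * G.eval z * P.eval z := by
          have := pow_ne_zero N hz0
          field_simp
          linear_combination e2
        have e4 : ∀ k, ((-1 : ℂ) ^ k / ((k.factorial : ℂ) * b j ^ k)) *
          iteratedDeriv k (fun z => Q z / Pj z) w * (1 - b j * z) ^ k =
            iteratedDeriv k (fun z => Q z / Pj z) w / (k.factorial : ℂ) * (z - w) ^ k := by
          intro k
          have h1 := pow_ne_zero k (hb0 j)
          have h2 : (k.factorial : ℂ) ≠ 0 := by exact_mod_cast k.factorial_ne_zero
          have h3 : (-1 : ℂ) ^ k * (-1) ^ k = 1 := by rw [← mul_pow]; simp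
          rw [hbw, mul_pow, neg_pow (b j)]
          field_simp
          linear_combination (iteratedDeriv k (fun z => Q z / Pj z) w * (z - w) ^ k) * h3
        have e5 : Q z / Pj z = _ := hgz z
        rw [div_eq_iff hz1] at e5
        simp only [eval_sub, eval_finsetSum, eval_mul, eval_pow, eval_C, eval_one, eval_X,
          eval_prod, e4]
        rw [← Finset.sum_mul, e3, e1]
        change _ - _ * Pj z = _
        rw [e5]
        ring)
    have hlin : (1 : ℂ[X]) - C (b j) * X = C (-b j) * (X - C w) := by
      rw [mul_sub, ← C_mul, hw, neg_mul, mul_inv_cancel₀ (hb0 j)]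
      simp; ring
    have hu : IsUnit (C (-b j) ^ m j : ℂ[X]) :=
      (isUnit_C.mpr (isUnit_iff_ne_zero.mpr (neg_ne_zero.mpr (hb0 j)))).pow _
    have hdv : ((1 : ℂ[X]) - C (b j) * X) ^ m j ∣ (X - C w) ^ m j := by
      rw [hlin, mul_pow]
      exact hu.mul_left_dvd.mpr dvd_rfl
    exact hdv.trans (Dvd.intro _ hU.symm))
  intro x hx
  have h1 := hRe x hx
  rw [hPe] at h1
  change _ * F x = _
  rw [← h1]
  conv_lhs => rw [key]
  simp [eval_finsetSum, eval_prod]
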